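/- Assume the dual-pair setup (B1)–(B5). Let T : X → X be a bounded linear operator with δ := inf_j ⟨T e_j, f_j⟩ > 0. Let L be a positive even integer, N ∈ ℕ with N ≥ L, and A ⊂ ℕ with |A| = N. Then the uniform average over all (B,(ε_k)) ∈ Ω_L^A of ⟨T b_B^ε, d_B^ε⟩ is at least [δ − C_d·‖T‖·ν(N)/(N−1)]·L. -/

import Mathlib

open scoped Classical
open Filter Topology

/-- The series `∑ u j` converges to `x` in the `σ(X,Y)`-topology induced by the
bilinear map `β` (convergence of the pairing of the partial sums against every `y ∈ Y`). -/
def SigmaHasSum {X Y : Type*} [NormedAddCommGroup X] [NormedSpace ℝ X]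
    [NormedAddCommGroup Y] [NormedSpace ℝ Y]
    (β : X →ₗ[ℝ] Y →ₗ[ℝ] ℝ) (u : ℕ → X) (x : X) : Prop :=
  ∀ y : Y, Tendsto (fun n => β (∑ j ∈ Finset.range n, u j) y) atTop (𝓝 (β x y))

/-- Axioms (B1)–(B5) for the dual pair `(X, Y, β)` together with the normalized
sequences `(e j) ⊆ X` and `(f j) ⊆ Y`:
(B1) `β` separates points of `X`; (B2) `β` separates points of `Y`;
(B3) `|β x y| ≤ Cd‖x‖‖y‖`; (B4) `(e j)` and `(f j)` are biorthogonal;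
(B5) every `x` has the (unique) representation `x = ∑ β x (f j) • e j`,
the series converging in the `σ(X,Y)`-topology. -/
def DualPair {X Y : Type*} [NormedAddCommGroup X] [NormedSpace ℝ X]
    [NormedAddCommGroup Y] [NormedSpace ℝ Y]
    (β : X →ₗ[ℝ] Y →ₗ[ℝ] ℝ) (Cd : ℝ) (e : ℕ → X) (f : ℕ → Y) : Prop :=
  (∀ x : X, (∀ y : Y, β x y = 0) → x = 0) ∧
  (∀ y : Y, (∀ x : X, β x y = 0) → y = 0) ∧
  (0 < Cd ∧ ∀ (x : X) (y : Y), |β x y| ≤ Cd * ‖x‖ * ‖y‖) ∧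
  (∀ j, ‖e j‖ = 1) ∧ (∀ j, ‖f j‖ = 1) ∧
  (∀ j k, β (e j) (f k) = if j = k then 1 else 0) ∧
  (∀ x : X, SigmaHasSum β (fun j => β x (f j) • e j) x) ∧
  (∀ (x : X) (a : ℕ → ℝ), SigmaHasSum β (fun j => a j • e j) x → ∀ j, a j = β x (f j))

/-- `(e j)` is `Cu`-unconditional (series converging in the `σ(X,Y)`-topology). -/
def SigmaUncond {X Y : Type*} [NormedAddCommGroup X] [NormedSpace ℝ X]
    [NormedAddCommGroup Y] [NormedSpace ℝ Y]
    (β : X →ₗ[ℝ] Y →ₗ[ℝ] ℝ) (e : ℕ → X) (Cu : ℝ) : Prop :=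
  ∀ (a γ : ℕ → ℝ) (x x' : X), BddAbove (Set.range fun k => |γ k|) →
    SigmaHasSum β (fun j => a j • e j) x →
    SigmaHasSum β (fun j => (γ j * a j) • e j) x' →
    ‖x'‖ ≤ Cu * (⨆ k, |γ k|) * ‖x‖

/-- `(e j)` is `Cs`-spreading (series converging in the `σ(X,Y)`-topology). -/
def SigmaSpreading {X Y : Type*} [NormedAddCommGroup X] [NormedSpace ℝ X]
    [NormedAddCommGroup Y] [NormedSpace ℝ Y]
    (β : X →ₗ[ℝ] Y →ₗ[ℝ] ℝ) (e : ℕ → X) (Cs : ℝ) : Prop :=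
  ∀ (a : ℕ → ℝ) (m : ℕ → ℕ), StrictMono m → ∀ (x x' : X),
    SigmaHasSum β (fun j => a j • e j) x →
    SigmaHasSum β (fun j => a j • e (m j)) x' →
    (1 / Cs) * ‖x'‖ ≤ ‖x‖ ∧ ‖x‖ ≤ Cs * ‖x'‖

/-- `(e j)` is non-`ℓ¹`-splicing, where `P Λ` denotes the basis projection onto the
coordinates in `Λ`: for every infinite `I ⊆ ℕ` and every `θ > 0` there are pairwise
disjoint infinite subsets `Λ j ⊆ I` such that for every sequence `(x j)` in the unit
ball of `X` there are scalars `(a j)` with `∑ |a j| = 1` and `‖∑ a j • P (Λ j) (x j)‖ ≤ θ`. -/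
def NonL1Splicing {X : Type*} [NormedAddCommGroup X] [NormedSpace ℝ X]
    (P : Set ℕ → X →L[ℝ] X) : Prop :=
  ∀ I : Set ℕ, I.Infinite → ∀ θ : ℝ, 0 < θ →
    ∃ Λ : ℕ → Set ℕ,
      (∀ j, (Λ j).Infinite) ∧ (∀ j, Λ j ⊆ I) ∧
      (∀ j k, j ≠ k → Disjoint (Λ j) (Λ k)) ∧
      ∀ x : ℕ → X, (∀ j, ‖x j‖ ≤ 1) →
        ∃ (a : ℕ → ℝ) (z : X),
          HasSum (fun j => |a j|) 1 ∧
          HasSum (fun j => a j • P (Λ j) (x j)) z ∧ ‖z‖ ≤ θ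

/-- The pairs `(B, S)` encoding the sign patterns of `Ω_L^A`. -/
noncomputable def signPatterns (L : ℕ) (A : Finset ℕ) : Finset (Finset ℕ × Finset ℕ) :=
  (A.powerset ×ˢ A.powerset).filter
    (fun q => q.1.card = L ∧ q.2 ⊆ q.1 ∧ 2 * q.2.card = L)

/-- The sign that the pattern `q = (B, S)` gives to `k`, extended by zero outside `B`. -/
noncomputable def patternSign (q : Finset ℕ × Finset ℕ) (k : ℕ) : ℝ :=
  if k ∈ q.1 then (if k ∈ q.2 then 1 else -1) else 0

lemma mem_signPatterns {L : ℕ} {A : Finset ℕ} {q : Finset ℕ × Finset ℕ} :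
    q ∈ signPatterns L A ↔
      q.1 ⊆ A ∧ q.2 ⊆ q.1 ∧ q.1.card = L ∧ 2 * q.2.card = L := by
  simp only [signPatterns, Finset.mem_filter, Finset.mem_product, Finset.mem_powerset]
  exact ⟨fun h => ⟨h.1.1, h.2.2.1, h.2.1, h.2.2.2⟩,
    fun h => ⟨⟨h.1, h.2.1.trans h.1⟩, h.2.2.1, h.2.1, h.2.2.2⟩⟩

lemma signPatterns_nonempty {L : ℕ} {A : Finset ℕ} (hL : Even L) (hLA : L ≤ A.card) :
    (signPatterns L A).Nonempty := by
  obtain ⟨m, rfl⟩ := hL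
  obtain ⟨B, hBA, hB⟩ := Finset.exists_subset_card_eq hLA
  obtain ⟨S, hSB, hS⟩ := Finset.exists_subset_card_eq (show m ≤ B.card by omega)
  exact ⟨(B, S), mem_signPatterns.2 ⟨hBA, hSB, hB, by simp only [hS]; ring⟩⟩

lemma map_perm_eq_of_mem_iff {A : Finset ℕ} {σ : Equiv.Perm ℕ}
    (hσ : ∀ k, σ k ∈ A ↔ k ∈ A) : A.map σ.toEmbedding = A := by
  ext k
  rw [Finset.mem_map_equiv, ← hσ, Equiv.apply_symm_apply]

/-- Sums over the sign patterns on `A` are invariant under permutations preserving `A`. -/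
lemma sum_signPatterns_perm (L : ℕ) {A : Finset ℕ} {σ : Equiv.Perm ℕ}
    (hσ : ∀ k, σ k ∈ A ↔ k ∈ A) (i j : ℕ) :
    ∑ q ∈ signPatterns L A, patternSign q (σ i) * patternSign q (σ j) =
      ∑ q ∈ signPatterns L A, patternSign q i * patternSign q j := by
  symm
  refine Finset.sum_equiv (σ.finsetCongr.prodCongr σ.finsetCongr) (fun q => ?_) (fun q _ => ?_)
  · simp only [mem_signPatterns, Equiv.prodCongr_apply, Prod.map, Equiv.finsetCongr_apply,
      Finset.card_map, Finset.map_subset_map]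
    conv_rhs => rw [← map_perm_eq_of_mem_iff hσ, Finset.map_subset_map]
  · simp [patternSign]

lemma swap_apply_mem_iff {A : Finset ℕ} {i j : ℕ} (hi : i ∈ A) (hj : j ∈ A) (k : ℕ) :
    Equiv.swap i j k ∈ A ↔ k ∈ A := by
  rw [Equiv.swap_apply_def]
  split_ifs <;> simp_all

lemma sum_patternSign_smul {V : Type*} [AddCommGroup V] [Module ℝ V]
    {L : ℕ} {A : Finset ℕ} {q : Finset ℕ × Finset ℕ}
    (hq : q ∈ signPatterns L A) (v : ℕ → V) :
    ∑ k ∈ q.1, (if k ∈ q.2 then (1 : ℝ) else -1) • v k = ∑ k ∈ A, patternSign q k • v k := by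
  rw [← Finset.sum_subset (mem_signPatterns.1 hq).1]
  · exact Finset.sum_congr rfl fun k hk => by simp [patternSign, hk]
  · intro k _ hk
    simp [patternSign, hk]

lemma sum_patternSign {L : ℕ} {A : Finset ℕ} {q : Finset ℕ × Finset ℕ}
    (hq : q ∈ signPatterns L A) : ∑ k ∈ A, patternSign q k = 0 := by
  have h := sum_patternSign_smul hq (fun _ => (1 : ℝ))
  simp only [smul_eq_mul, mul_one] at h
  obtain ⟨-, hS, hB, hS2⟩ := mem_signPatterns.1 hq
  have hcard := Finset.card_sdiff_add_card_eq_card hS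
  rw [← h, Finset.sum_ite, Finset.filter_mem_eq_inter, Finset.inter_eq_right.2 hS,
    Finset.filter_notMem_eq_sdiff]
  simp only [Finset.sum_const, nsmul_eq_mul]
  have h1 : (q.1 \ q.2).card = q.2.card := by omega
  rw [h1]
  ring

lemma sum_patternSign_mul_self {L : ℕ} {A : Finset ℕ} {q : Finset ℕ × Finset ℕ}
    (hq : q ∈ signPatterns L A) : ∑ k ∈ A, patternSign q k * patternSign q k = L := by
  obtain ⟨hA, -, hB, -⟩ := mem_signPatterns.1 hq
  have h (k : ℕ) : patternSign q k * patternSign q k = if k ∈ q.1 then 1 else 0 := by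
    unfold patternSign
    split_ifs <;> norm_num
  simp_rw [h]
  rw [Finset.sum_ite_mem, Finset.inter_eq_right.2 hA]
  simp [hB]

lemma card_mul_sum_patternSign_mul_self (L : ℕ) {A : Finset ℕ} {i : ℕ} (hi : i ∈ A) :
    (A.card : ℝ) * ∑ q ∈ signPatterns L A, patternSign q i * patternSign q i =
      (signPatterns L A).card * L := by
  have h : ∀ j ∈ A, ∑ q ∈ signPatterns L A, patternSign q j * patternSign q j =
      ∑ q ∈ signPatterns L A, patternSign q i * patternSign q i := fun j hj => by
    simpa using sum_signPatterns_perm L (swap_apply_mem_iff hi hj) i i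
  rw [← nsmul_eq_mul, ← Finset.sum_const, ← Finset.sum_congr rfl h, Finset.sum_comm,
    Finset.sum_congr rfl fun q hq => sum_patternSign_mul_self hq, Finset.sum_const, nsmul_eq_mul]

lemma card_sub_one_mul_sum_patternSign_mul (L : ℕ) {A : Finset ℕ} {i j : ℕ}
    (hi : i ∈ A) (hj : j ∈ A) (hij : i ≠ j) :
    ((A.card : ℝ) - 1) * ∑ q ∈ signPatterns L A, patternSign q i * patternSign q j =
      -∑ q ∈ signPatterns L A, patternSign q i * patternSign q i := by
  have h : ∀ k ∈ A.erase i, ∑ q ∈ signPatterns L A, patternSign q i * patternSign q k =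
      ∑ q ∈ signPatterns L A, patternSign q i * patternSign q j := fun k hk => by
    obtain ⟨hki, hk⟩ := Finset.mem_erase.1 hk
    simpa [Equiv.swap_apply_of_ne_of_ne hij hki.symm] using
      sum_signPatterns_perm L (swap_apply_mem_iff hj hk) i j
  have h0 : ∑ k ∈ A, ∑ q ∈ signPatterns L A, patternSign q i * patternSign q k = 0 := by
    rw [Finset.sum_comm]
    refine Finset.sum_eq_zero fun q hq => ?_
    rw [← Finset.mul_sum, sum_patternSign hq, mul_zero]
  rw [← Finset.add_sum_erase _ _ hi, Finset.sum_congr rfl h, Finset.sum_const, nsmul_eq_mul,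
    Finset.cast_card_erase_of_mem hi] at h0
  linarith

lemma le_biSup_finset {A : Finset ℕ} {g : ℕ → ℝ} (hg : ∀ k, 0 ≤ g k) {i : ℕ} (hi : i ∈ A) :
    g i ≤ ⨆ k ∈ A, g k := by
  have hk (k : ℕ) : (⨆ _ : k ∈ A, g k) ≤ ∑ j ∈ A, g j := by
    by_cases h : k ∈ A
    · simpa [h] using Finset.single_le_sum (fun j _ => hg j) h
    · simpa [h] using Finset.sum_nonneg fun j _ => hg j
  refine le_trans (le_of_eq ?_) (le_ciSup ⟨_, Set.forall_mem_range.2 hk⟩ i)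
  simp [hi]

lemma sum_offDiag_le {X Y : Type*} [NormedAddCommGroup X] [NormedSpace ℝ X]
    [NormedAddCommGroup Y] [NormedSpace ℝ Y]
    (β : X →ₗ[ℝ] Y →ₗ[ℝ] ℝ) {Cd : ℝ} (hCd : 0 ≤ Cd)
    (hβ : ∀ (x : X) (y : Y), |β x y| ≤ Cd * ‖x‖ * ‖y‖) {e : ℕ → X} {f : ℕ → Y}
    (he : ∀ j, ‖e j‖ = 1) (hf : ∀ j, ‖f j‖ = 1) (T : X →L[ℝ] X) {A : Finset ℕ} {ν : ℝ}
    (hν : min (⨆ l ∈ A, ‖∑ k ∈ A.erase l, e k‖) (⨆ k ∈ A, ‖∑ l ∈ A.erase k, f l‖) ≤ ν) :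
    ∑ j ∈ A, ∑ k ∈ A.erase j, β (T (e j)) (f k) ≤ A.card * (Cd * ‖T‖ * ν) := by
  rw [← nsmul_eq_mul]
  rcases min_le_iff.1 hν with h | h
  · have hcomm : ∑ j ∈ A, ∑ k ∈ A.erase j, β (T (e j)) (f k) =
        ∑ k ∈ A, ∑ j ∈ A.erase k, β (T (e j)) (f k) :=
      Finset.sum_comm' fun j k => by simp only [Finset.mem_erase]; tauto
    rw [hcomm]
    refine Finset.sum_le_card_nsmul _ _ _ fun k hk => ?_
    have hk' := (le_biSup_finset (g := fun l => ‖∑ k ∈ A.erase l, e k‖)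
      (fun _ => norm_nonneg _) hk).trans h
    calc ∑ j ∈ A.erase k, β (T (e j)) (f k) = β (T (∑ j ∈ A.erase k, e j)) (f k) := by
          simp [map_sum, LinearMap.sum_apply]
      _ ≤ Cd * ‖T (∑ j ∈ A.erase k, e j)‖ * ‖f k‖ := (le_abs_self _).trans (hβ _ _)
      _ ≤ Cd * (‖T‖ * ν) * 1 := by
          rw [hf]
          gcongr
          exact T.le_opNorm_of_le hk'
      _ = Cd * ‖T‖ * ν := by ring
  · refine Finset.sum_le_card_nsmul _ _ _ fun j hj => ?_
    have hj' := (le_biSup_finset (g := fun k => ‖∑ l ∈ A.erase k, f l‖)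
      (fun _ => norm_nonneg _) hj).trans h
    calc ∑ k ∈ A.erase j, β (T (e j)) (f k) = β (T (e j)) (∑ k ∈ A.erase j, f k) := by
          simp [map_sum]
      _ ≤ Cd * ‖T (e j)‖ * ‖∑ k ∈ A.erase j, f k‖ := (le_abs_self _).trans (hβ _ _)
      _ ≤ Cd * ‖T‖ * ν := by
          gcongr
          exact (T.le_opNorm_of_le (he j).le).trans_eq (mul_one _)

/-- Diagonal averaging lemma: under (B1)–(B5), if `T : X → X` is bounded
with `δ := inf_j ⟨T e_j, f_j⟩ > 0`, `L` is a positive even integer, `N ≥ L` and `|A| = N`,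
then the uniform average over `Ω_L^A = {(B, ε) : B ⊆ A, |B| = L, ε ∈ E(B)}` (signs `ε`
encoded by the set `S = {k ∈ B : ε k = 1}`, `2|S| = L`) of `⟨T b_B^ε, d_B^ε⟩` is at least
`[δ − Cd‖T‖ν(N)/(N−1)]·L`, where `ν` is any upper bound for the quantities
`min(max_{l∈A'} ‖∑_{k∈A'∖{l}} e k‖, max_{k∈A'} ‖∑_{l∈A'∖{k}} f l‖)` over all `A'` with
`|A'| = N`. -/
theorem diagonal_average_lower_bound
    {X Y : Type*} [NormedAddCommGroup X] [NormedSpace ℝ X] [CompleteSpace X]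
    [NormedAddCommGroup Y] [NormedSpace ℝ Y] [CompleteSpace Y]
    (β : X →ₗ[ℝ] Y →ₗ[ℝ] ℝ) (Cd : ℝ) (e : ℕ → X) (f : ℕ → Y)
    (hdp : DualPair β Cd e f)
    (T : X →L[ℝ] X) (δ : ℝ) (hδ : 0 < δ)
    (hdiag : ∀ j, δ ≤ β (T (e j)) (f j))
    (L N : ℕ) (hL : 0 < L) (hLeven : Even L) (hNL : L ≤ N)
    (A : Finset ℕ) (hA : A.card = N)
    (ν : ℝ)
    (hν : ∀ A' : Finset ℕ, A'.card = N →
      min (⨆ l ∈ A', ‖∑ k ∈ A'.erase l, e k‖) (⨆ k ∈ A', ‖∑ l ∈ A'.erase k, f l‖) ≤ ν) :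
    ((((A.powerset ×ˢ A.powerset).filter
        (fun q => q.1.card = L ∧ q.2 ⊆ q.1 ∧ 2 * q.2.card = L)).card : ℝ))⁻¹ *
      ∑ q ∈ (A.powerset ×ˢ A.powerset).filter
          (fun q => q.1.card = L ∧ q.2 ⊆ q.1 ∧ 2 * q.2.card = L),
        β (T (∑ k ∈ q.1, (if k ∈ q.2 then (1 : ℝ) else -1) • e k))
          (∑ k ∈ q.1, (if k ∈ q.2 then (1 : ℝ) else -1) • f k)
      ≥ (δ - Cd * ‖T‖ * ν / ((N : ℝ) - 1)) * L := by
  obtain ⟨-, -, ⟨hCd, hβ⟩, he, hf, -, -, -⟩ := hdp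
  subst hA
  change ((signPatterns L A).card : ℝ)⁻¹ * ∑ q ∈ signPatterns L A,
    β (T (∑ k ∈ q.1, (if k ∈ q.2 then (1 : ℝ) else -1) • e k))
      (∑ k ∈ q.1, (if k ∈ q.2 then (1 : ℝ) else -1) • f k) ≥ _
  set Ω := signPatterns L A with hΩ
  have hΩpos : (0 : ℝ) < Ω.card := by
    exact_mod_cast (signPatterns_nonempty hLeven hNL).card_pos
  have hA2 : (2 : ℝ) ≤ A.card := by
    obtain ⟨m, rfl⟩ := hLeven
    exact_mod_cast (show 2 ≤ A.card by omega)
  have hA1 : (0 : ℝ) < (A.card : ℝ) - 1 := by linarith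
  have hoff := sum_offDiag_le β hCd.le hβ he hf T (hν A rfl)
  set D := ∑ j ∈ A, ∑ k ∈ A.erase j, β (T (e j)) (f k)
  have hdiagsum : A.card * δ ≤ ∑ j ∈ A, β (T (e j)) (f j) := by
    rw [← nsmul_eq_mul]
    exact Finset.card_nsmul_le_sum _ _ _ fun j _ => hdiag j
  set M : ℝ := Ω.card * L / A.card with hM
  have hMpos : 0 < M := by positivity
  have hself : ∀ j ∈ A, ∑ q ∈ Ω, patternSign q j * patternSign q j = M := fun j hj => by
    rw [hM, eq_div_iff (by positivity), mul_comm]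
    exact card_mul_sum_patternSign_mul_self L hj
  have hcross : ∀ j ∈ A, ∀ k ∈ A.erase j,
      ∑ q ∈ Ω, patternSign q j * patternSign q k = -M / (A.card - 1) := fun j hj k hk => by
    obtain ⟨hkj, hk⟩ := Finset.mem_erase.1 hk
    rw [eq_div_iff hA1.ne', mul_comm, ← hself j hj]
    exact card_sub_one_mul_sum_patternSign_mul L hj hk hkj.symm
  have hsum : ∑ q ∈ Ω, β (T (∑ k ∈ q.1, (if k ∈ q.2 then (1 : ℝ) else -1) • e k))
      (∑ k ∈ q.1, (if k ∈ q.2 then (1 : ℝ) else -1) • f k) =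
      M * ∑ j ∈ A, β (T (e j)) (f j) + -M / (A.card - 1) * D := by
    calc _ = ∑ q ∈ Ω, ∑ j ∈ A, ∑ k ∈ A,
          patternSign q j * patternSign q k * β (T (e j)) (f k) := by
          refine Finset.sum_congr rfl fun q hq => ?_
          rw [sum_patternSign_smul hq, sum_patternSign_smul hq]
          simp only [map_sum, LinearMap.sum_apply, map_smul, LinearMap.smul_apply, smul_eq_mul,
            Finset.mul_sum]
          rw [Finset.sum_comm]
          exact Finset.sum_congr rfl fun j _ => Finset.sum_congr rfl fun k _ => by ring
      _ = ∑ j ∈ A, ∑ k ∈ A,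
          (∑ q ∈ Ω, patternSign q j * patternSign q k) * β (T (e j)) (f k) := by
          rw [Finset.sum_comm]
          refine Finset.sum_congr rfl fun j _ => ?_
          rw [Finset.sum_comm]
          exact Finset.sum_congr rfl fun k _ => (Finset.sum_mul _ _ _).symm
      _ = ∑ j ∈ A, (M * β (T (e j)) (f j) +
          -M / (A.card - 1) * ∑ k ∈ A.erase j, β (T (e j)) (f k)) := by
          refine Finset.sum_congr rfl fun j hj => ?_
          rw [← Finset.add_sum_erase _ _ hj, hself j hj, Finset.mul_sum]
          exact congrArg _ (Finset.sum_congr rfl fun k hk => by rw [hcross j hj k hk])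
      _ = _ := by rw [Finset.sum_add_distrib, ← Finset.mul_sum, ← Finset.mul_sum]
  rw [hsum, ge_iff_le, inv_mul_eq_div, le_div_iff₀ hΩpos]
  calc (δ - Cd * ‖T‖ * ν / (A.card - 1)) * L * Ω.card
      = M * (A.card * δ) - M / (A.card - 1) * (A.card * (Cd * ‖T‖ * ν)) := by
        rw [hM]
        field_simp
    _ ≤ M * ∑ j ∈ A, β (T (e j)) (f j) - M / (A.card - 1) * D := by gcongr
    _ = _ := by ring
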